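/- arXiv:1703.04815 — 2 statements merged into one kernel-verified Lean document; each statement's English description precedes it below -/
import Mathlib

section
/- For every integer r ≥ 4 there exists a constant Δ₀ such that for every real Δ ≥ Δ₀, every real d with (ln Δ)^8 ≤ d ≤ Δ, and every real X with 1/(ln Δ)^2 ≤ X ≤ 1, one has Δ^{r-1}·(X·d − √(X·d)·ln Δ) + d·Δ^{r-1}/(8·ln Δ) > X·d·Δ^{r-1} + √(X·d·Δ^{r-1})·ln Δ. -/
theorem key_inequality_for_B (r : ℕ) (hr : 4 ≤ r) :
    ∃ Δ₀ : ℝ, ∀ Δ : ℝ, Δ₀ ≤ Δ →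
    ∀ d : ℝ, (Real.log Δ) ^ 8 ≤ d → d ≤ Δ →
    ∀ X : ℝ, 1 / (Real.log Δ) ^ 2 ≤ X → X ≤ 1 →
    X * d * Δ ^ (r - 1) + Real.sqrt (X * d * Δ ^ (r - 1)) * Real.log Δ <
      Δ ^ (r - 1) * (X * d - Real.sqrt (X * d) * Real.log Δ) +
        d * Δ ^ (r - 1) / (8 * Real.log Δ) := by
  refine ⟨Real.exp 5, fun Δ hΔ d hd _ X hX hX1 => ?_⟩
  have hΔpos : 0 < Δ := (Real.exp_pos 5).trans_le hΔ
  have hL : 5 ≤ Real.log Δ := (Real.le_log_iff_exp_le hΔpos).2 hΔ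
  have hM : 1 ≤ Δ ^ (r - 1) :=
    one_le_pow₀ ((Real.one_le_exp (by norm_num)).trans hΔ)
  set L := Real.log Δ
  set M := Δ ^ (r - 1)
  have hLpos : 0 < L := by linarith
  have hdpos : 0 < d := (pow_pos hLpos 8).trans_le hd
  have hXpos : 0 < X := lt_of_lt_of_le (by positivity) hX
  have hsqrtM : √M ≤ M := Real.sqrt_le_iff.2 ⟨by positivity, le_self_pow₀ hM two_ne_zero⟩
  have hsqrtXd : √(X * d) ≤ √d :=
    Real.sqrt_le_sqrt (mul_le_of_le_one_left hdpos.le hX1)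
  have hsqrtd : L ^ 4 ≤ √d := Real.le_sqrt_of_sq_le (by linarith [pow_mul L 4 2])
  have hlarge : 16 * L ^ 2 < √d := by
    have : 16 < L ^ 2 := by nlinarith
    nlinarith
  have hlead : 2 * √(X * d) * L < d / (8 * L) := by
    rw [lt_div_iff₀ (by positivity)]
    calc 2 * √(X * d) * L * (8 * L) = 16 * L ^ 2 * √(X * d) := by ring
      _ ≤ 16 * L ^ 2 * √d := by gcongr
      _ < √d * √d := by gcongr
      _ = d := Real.mul_self_sqrt hdpos.le
  have hcross : √(X * d) * √M * L ≤ √(X * d) * M * L := by gcongr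
  have hscaled : 2 * √(X * d) * L * M < d / (8 * L) * M := by gcongr
  rw [Real.sqrt_mul (by positivity : 0 ≤ X * d), mul_div_right_comm]
  linarith
end

section
/- For every integer r ≥ 4 there exists a constant Δ₀ such that the following holds for every real Δ ≥ Δ₀, all reals q, Q with Δ^{r-1}/ln Δ ≤ q < Δ^{r-1}/ln Δ + 96 and 2·Δ^{r-1} + Δ^{r-1}/ln Δ ≤ Q < 2·Δ^{r-1} + 2·Δ^{r-1}/ln Δ + 96, every real d with (ln Δ)^8 ≤ d ≤ Δ, and every real X with 1/(ln Δ)^2 ≤ X ≤ 1 − 1/(ln Δ)^3: writing D = X·d − √(X·d)·ln Δ, one has ((Q/q)·D + (d − D))·(q − 2Δ) ≥ 2·Δ^{r-1}·D + (1/4)·d·Δ^{r-1}/ln Δ. -/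
theorem attainable_sums_lower_bound (r : ℕ) (hr : 4 ≤ r) :
    ∃ Δ₀ : ℝ, ∀ Δ : ℝ, Δ₀ ≤ Δ →
    ∀ q Q : ℝ,
    Δ ^ (r - 1) / Real.log Δ ≤ q → q < Δ ^ (r - 1) / Real.log Δ + 96 →
    2 * Δ ^ (r - 1) + Δ ^ (r - 1) / Real.log Δ ≤ Q →
    Q < 2 * Δ ^ (r - 1) + 2 * Δ ^ (r - 1) / Real.log Δ + 96 →
    ∀ d : ℝ, (Real.log Δ) ^ 8 ≤ d → d ≤ Δ →
    ∀ X : ℝ, 1 / (Real.log Δ) ^ 2 ≤ X → X ≤ 1 - 1 / (Real.log Δ) ^ 3 →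
    letI D : ℝ := X * d - Real.sqrt (X * d) * Real.log Δ
    (Q / q * D + (d - D)) * (q - 2 * Δ) ≥
      2 * Δ ^ (r - 1) * D + 1 / 4 * (d * Δ ^ (r - 1) / Real.log Δ) := by
  have hlog : ∀ᶠ Δ : ℝ in Filter.atTop, 100 ≤ Δ ∧ 1 ≤ Real.log Δ ∧ 4 * Real.log Δ ≤ Δ := by
    have hlittle := Real.isLittleO_log_id_atTop.bound (show (0 : ℝ) < 1 / 4 by norm_num)
    filter_upwards [Filter.eventually_ge_atTop (100 : ℝ), hlittle,
      Real.tendsto_log_atTop.eventually_ge_atTop 1] with Δ h100 hbound hone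
    rw [Real.norm_of_nonneg (by linarith), id, Real.norm_of_nonneg (by linarith)] at hbound
    exact ⟨h100, hone, by linarith⟩
  obtain ⟨Δ₀, hΔ₀⟩ := Filter.eventually_atTop.1 hlog
  refine ⟨Δ₀, fun Δ hΔ q Q hq _ hQ hQ' d hd _ X hX hX' => ?_⟩
  obtain ⟨h100, hL, hLΔ⟩ := hΔ₀ Δ hΔ
  have hP : Δ ^ 3 ≤ Δ ^ (r - 1) := pow_le_pow_right₀ (by linarith) (by omega)
  generalize Real.log Δ = L at *
  generalize Δ ^ (r - 1) = P at *
  have hL0 : 0 < L := by linarith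
  have hP96 : 96 ≤ P := by nlinarith [pow_le_pow_left₀ (by norm_num) h100 3]
  have hd0 : 0 < d := lt_of_lt_of_le (by positivity) hd
  have hX1 : X ≤ 1 := by linarith [show 0 < 1 / L ^ 3 by positivity]
  have hXd : L ^ 6 ≤ X * d := by
    calc L ^ 6 = 1 / L ^ 2 * L ^ 8 := by field_simp
      _ ≤ X * d := mul_le_mul hX hd (by positivity) (le_trans (by positivity) hX)
  have hsqrt : L ≤ √(X * d) :=
    Real.le_sqrt_of_sq_le ((pow_le_pow_right₀ hL (by norm_num)).trans hXd)
  have hsq : √(X * d) * √(X * d) = X * d :=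
    Real.mul_self_sqrt (le_trans (by positivity) hXd)
  have hD0 : 0 ≤ X * d - √(X * d) * L := by nlinarith
  have hDd : X * d - √(X * d) * L ≤ d := by
    nlinarith [mul_nonneg (Real.sqrt_nonneg (X * d)) hL0.le]
  change (Q / q * (X * d - √(X * d) * L) + (d - (X * d - √(X * d) * L))) * (q - 2 * Δ) ≥
    2 * P * (X * d - √(X * d) * L) + 1 / 4 * (d * P / L)
  generalize X * d - √(X * d) * L = D at *
  rw [mul_div_assoc] at hQ' ⊢
  obtain ⟨p, hp⟩ : ∃ p, p = P / L := ⟨_, rfl⟩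
  have hpL : p * L = P := by rw [hp]; field_simp
  rw [← hp] at hq hQ hQ' ⊢
  have hp0 : 0 < p := by rw [hp]; positivity
  have hq0 : 0 < q := by linarith
  have hratio : Q / q ≤ 5 * L := by
    rw [div_le_iff₀ hq0]
    nlinarith [mul_le_mul_of_nonneg_right hq hL0.le]
  have hmul : Q / q * q = Q := div_mul_cancel₀ Q hq0.ne'
  have hsmall : 16 * Δ * L ≤ p := by
    rw [hp, le_div_iff₀ hL0]
    refine le_trans ?_ hP
    have : (4 * L) ^ 2 ≤ Δ ^ 2 := pow_le_pow_left₀ (by positivity) hLΔ 2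
    nlinarith
  generalize Q / q = t at *
  have hΔ0 : 0 < Δ := by linarith
  have herr : t * D * Δ ≤ 5 * L * d * Δ := by gcongr
  have hmain : D * (2 * P + p) ≤ D * Q := mul_le_mul_of_nonneg_left hQ hD0
  have hrest : (d - D) * p ≤ (d - D) * q := mul_le_mul_of_nonneg_left hq (by linarith)
  have hdp : d * (16 * Δ * L) ≤ d * p := mul_le_mul_of_nonneg_left hsmall hd0.le
  have hdΔ : d * Δ ≤ d * Δ * L := le_mul_of_one_le_right (by positivity) hL
  have hDΔ : 0 ≤ D * Δ := by positivity
  have hexpand : (t * D + (d - D)) * (q - 2 * Δ) =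
      D * Q + (d - D) * q - 2 * (t * D * Δ) - 2 * (d * Δ) + 2 * (D * Δ) := by
    rw [← hmul]; ring
  rw [hexpand]
  linarith
end
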